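/- Let p ≥ 5 be a prime, let k be an integer with 2 ≤ k ≤ (p−1)/2, and let m ≥ k + 3 be an integer. Then there is no integer j with 0 ≤ j ≤ pm − k² − 1 satisfying j² − (pm − k²)·j + p + pm − k² = 0. -/

import Mathlib

/-- Equation (27): for `p ≥ 5` prime, `2 ≤ k ≤ (p-1)/2` and `m ≥ k+3`, the quadratic
`j² - (pm - k²)·j + p + pm - k²` has no integer root in `[0, pm - k² - 1]`. -/
theorem no_root_eq27 (p k m : ℤ) (hp : Prime p) (hp5 : 5 ≤ p)
    (hk2 : 2 ≤ k) (hk : k ≤ (p - 1) / 2) (hm : k + 3 ≤ m) :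
    ¬ ∃ j : ℤ, 0 ≤ j ∧ j ≤ p * m - k ^ 2 - 1 ∧
      j ^ 2 - (p * m - k ^ 2) * j + p + p * m - k ^ 2 = 0 := by
  rintro ⟨j, hj0, hjN, hj⟩
  have hpk : 2 * k + 1 ≤ p := by omega
  have hN : p + 4 < p * m - k ^ 2 := by
    nlinarith [mul_le_mul_of_nonneg_left hm (by linarith : (0 : ℤ) ≤ p),
      mul_le_mul_of_nonneg_right hpk (by linarith : (0 : ℤ) ≤ k + 2)]
  generalize hNdef : p * m - k ^ 2 = N at hjN hN hj
  replace hj : j ^ 2 - N * j + p + N = 0 := by linarith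
  obtain rfl | rfl | rfl | ⟨h2, hN2⟩ :
      j = 0 ∨ j = 1 ∨ j = N - 1 ∨ (2 ≤ j ∧ j ≤ N - 2) := by omega
  · linarith
  · linarith
  · linarith
  · nlinarith [mul_nonneg (sub_nonneg.2 h2) (sub_nonneg.2 hN2)]
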